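/- arXiv:1809.10885 — 4 statements merged into one kernel-verified Lean document; each statement's English description precedes it below -/
import Mathlib

section
/- (Lemma 2.1) Let Y₀ be a solution of the matrix Riccati equation Y' + Y Q(t) Y + Y P(t) − S(t) Y − R(t) = 0 on [t₁, t₂) with t₀ ≤ t₁ < t₂ < +∞. If the function f(t) = ∫_{t₁}^{t} tr[Q(τ) Y₀(τ)] dτ is bounded from below on [t₁, t₂), then [t₁, t₂) is not the maximum existence interval for Y₀: there exist t₃ > t₂ and a solution Ỹ of the same Riccati equation on [t₁, t₃) with Ỹ(t) = Y₀(t) for all t ∈ [t₁, t₂). -/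
open Set Filter MeasureTheory intervalIntegral Matrix

noncomputable section

abbrev Mat2 := Matrix (Fin 2) (Fin 2) ℝ

open scoped Matrix.Norms.Operator

section LinearODE

variable {E : Type*} [NormedAddCommGroup E] [NormedSpace ℝ E] [CompleteSpace E]

/-- A globally Lipschitz vector field vanishing at `0` can be integrated over any time interval
of length at most `1 / (2 * K)`, independently of the initial value. -/
theorem exists_hasDerivWithinAt_of_lipschitzWith {f : ℝ → E → E} {a b : ℝ} {K : NNReal}
    (hab : a ≤ b) (hf : ∀ t ∈ Icc a b, LipschitzWith K (f t)) (hf0 : ∀ t ∈ Icc a b, f t 0 = 0)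
    (hcont : ∀ x, ContinuousOn (fun t => f t x) (Icc a b)) (hK : 2 * (K * (b - a)) ≤ 1)
    (x₀ : E) :
    ∃ α : ℝ → E, α a = x₀ ∧
      ∀ t ∈ Icc a b, HasDerivWithinAt α (f t (α t)) (Icc a b) t := by
  have key : IsPicardLindelof f (⟨a, left_mem_Icc.2 hab⟩ : Icc a b) x₀ ‖x₀‖₊ 0
      (K * (2 * ‖x₀‖₊)) K := by
    refine ⟨fun t ht => (hf t ht).lipschitzOnWith, fun x _ => hcont x, fun t ht x hx => ?_, ?_⟩
    · have h1 := (hf t ht).dist_le_mul x 0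
      rw [hf0 t ht, dist_zero_right, dist_zero_right] at h1
      have h2 : ‖x‖ ≤ 2 * ‖x₀‖ := by
        have h3 : ‖x - x₀‖ ≤ ‖x₀‖ := by simpa [dist_eq_norm] using hx
        have h4 := norm_le_norm_add_norm_sub' x x₀
        linarith
      push_cast
      exact h1.trans (mul_le_mul_of_nonneg_left h2 K.2)
    · have h1 : max (b - a) (a - a) = b - a := max_eq_left (by linarith)
      push_cast
      rw [h1]
      have := norm_nonneg x₀
      nlinarith
  exact key.exists_eq_forall_mem_Icc_hasDerivWithinAt₀

end LinearODE

section Riccati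

variable {A : Type*} [NormedRing A]

/-- The linear system associated with a Riccati equation is Lipschitz. -/
theorem lipschitzWith_linearSystem {C : NNReal} {p q r s : A} (hp : ‖p‖ ≤ C) (hq : ‖q‖ ≤ C)
    (hr : ‖r‖ ≤ C) (hs : ‖s‖ ≤ C) :
    LipschitzWith (2 * C) (fun z : A × A => (p * z.1 + q * z.2, r * z.1 + s * z.2)) := by
  have key : ∀ {p q : A}, ‖p‖ ≤ C → ‖q‖ ≤ C → ∀ z w : A × A,
      ‖p * z.1 + q * z.2 - (p * w.1 + q * w.2)‖ ≤ 2 * C * ‖z - w‖ := by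
    intro p q hp hq z w
    have e : p * z.1 + q * z.2 - (p * w.1 + q * w.2) = p * (z - w).1 + q * (z - w).2 := by
      simp only [Prod.fst_sub, Prod.snd_sub]; noncomm_ring
    rw [e]
    calc ‖p * (z - w).1 + q * (z - w).2‖ ≤ ‖p‖ * ‖(z - w).1‖ + ‖q‖ * ‖(z - w).2‖ :=
          (norm_add_le _ _).trans (add_le_add (norm_mul_le _ _) (norm_mul_le _ _))
      _ ≤ C * ‖z - w‖ + C * ‖z - w‖ := by
          gcongr
          · exact norm_fst_le _
          · exact norm_snd_le _
      _ = 2 * C * ‖z - w‖ := by ring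
  refine LipschitzWith.of_dist_le_mul fun z w => ?_
  rw [dist_eq_norm, dist_eq_norm]
  push_cast
  exact max_le (key hp hq z w) (key hr hs z w)

/-- If `(Φ, Ψ)` solves the linear system associated with a Riccati equation and `Φ` is invertible,
then `Ψ * Φ⁻¹` solves the Riccati equation. -/
theorem hasDerivWithinAt_mul_ringInverse [NormedAlgebra ℝ A] [HasSummableGeomSeries A] {Φ Ψ : ℝ → A} {p q r s : A}
    {u : Set ℝ} {t : ℝ} (hΦ : HasDerivWithinAt Φ (p * Φ t + q * Ψ t) u t)
    (hΨ : HasDerivWithinAt Ψ (r * Φ t + s * Ψ t) u t) (hu : IsUnit (Φ t)) :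
    HasDerivWithinAt (fun τ => Ψ τ * Ring.inverse (Φ τ))
      (s * (Ψ t * Ring.inverse (Φ t)) + r
        - Ψ t * Ring.inverse (Φ t) * q * (Ψ t * Ring.inverse (Φ t))
        - Ψ t * Ring.inverse (Φ t) * p) u t := by
  obtain ⟨v, hv⟩ := hu
  have hinv := (hv ▸ hasFDerivAt_ringInverse (𝕜 := ℝ) v :
    HasFDerivAt Ring.inverse (-ContinuousLinearMap.mulLeftRight ℝ A ↑v⁻¹ ↑v⁻¹) (Φ t))
  refine (hΨ.mul (hinv.comp_hasDerivWithinAt t hΦ)).congr_deriv ?_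
  simp only [Function.comp_apply, ← hv, Ring.inverse_unit, _root_.neg_apply,
    ContinuousLinearMap.mulLeftRight_apply]
  simp only [mul_add, add_mul, mul_assoc, Units.mul_inv, mul_one,
    mul_neg]
  noncomm_ring

/-- Solutions of a Riccati equation are determined by the associated linear system. -/
theorem eq_mul_of_linearSystem [NormedAlgebra ℝ A] {P Q R S Y Φ Ψ : ℝ → A} {a b : ℝ}
    (hS : ContinuousOn S (Icc a b)) (hQ : ContinuousOn Q (Icc a b))
    (hY : ∀ t ∈ Icc a b, HasDerivWithinAt Y
      (S t * Y t + R t - Y t * Q t * Y t - Y t * P t) (Icc a b) t)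
    (hΦ : ∀ t ∈ Icc a b, HasDerivWithinAt Φ (P t * Φ t + Q t * Ψ t) (Icc a b) t)
    (hΨ : ∀ t ∈ Icc a b, HasDerivWithinAt Ψ (R t * Φ t + S t * Ψ t) (Icc a b) t)
    (h0 : Ψ a = Y a * Φ a) {t : ℝ} (ht : t ∈ Icc a b) : Ψ t = Y t * Φ t := by
  have hYc : ContinuousOn Y (Icc a b) := fun t ht => (hY t ht).continuousWithinAt
  have hder : ∀ t ∈ Icc a b, HasDerivWithinAt (fun τ => Ψ τ - Y τ * Φ τ)
      ((S t - Y t * Q t) * (Ψ t - Y t * Φ t)) (Icc a b) t := by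
    intro t ht
    refine ((hΨ t ht).sub ((hY t ht).mul (hΦ t ht))).congr_deriv ?_
    noncomm_ring
  obtain ⟨C, hC⟩ := isCompact_Icc.exists_bound_of_continuousOn (hS.sub (hYc.mul hQ))
  have := eq_zero_of_abs_deriv_le_mul_abs_self_of_eq_zero_right (K := C)
    (fun t ht => (hder t ht).continuousWithinAt)
    (fun t ht => (hder t (Ico_subset_Icc_self ht)).mono_of_mem_nhdsWithin
      (Icc_mem_nhdsGE_of_mem ht)) (by simp [h0])
    (fun t ht => (norm_mul_le _ _).trans
      (mul_le_mul_of_nonneg_right (hC t (Ico_subset_Icc_self ht)) (norm_nonneg _))) t ht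
  exact sub_eq_zero.1 this

/-- Near the right end point of its interval, a solution of a Riccati equation is described by a
solution of the associated linear system which lives beyond this end point. -/
theorem exists_linearSystem_past_endpoint [NormedAlgebra ℝ A] [CompleteSpace A]
    {P Q R S Y : ℝ → A} {t₁ t₂ b : ℝ} (h₁₂ : t₁ < t₂) (h₂b : t₂ < b) (hP : ContinuousOn P (Icc t₁ b)) (hQ : ContinuousOn Q (Icc t₁ b))
    (hR : ContinuousOn R (Icc t₁ b)) (hS : ContinuousOn S (Icc t₁ b))
    (hY : ∀ t ∈ Ico t₁ t₂, HasDerivWithinAt Y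
      (S t * Y t + R t - Y t * Q t * Y t - Y t * P t) (Ico t₁ t₂) t) :
    ∃ T ∈ Ico t₁ t₂, ∃ c ∈ Ioc t₂ b, ∃ Φ Ψ : ℝ → A, Φ T = 1 ∧
      (∀ t ∈ Icc T c, HasDerivWithinAt Φ (P t * Φ t + Q t * Ψ t) (Icc T c) t) ∧
      (∀ t ∈ Icc T c, HasDerivWithinAt Ψ (R t * Φ t + S t * Ψ t) (Icc T c) t) ∧
      ∀ t ∈ Ico T t₂, Ψ t = Y t * Φ t := by
  obtain ⟨C₁, hC₁⟩ := isCompact_Icc.exists_bound_of_continuousOn hP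
  obtain ⟨C₂, hC₂⟩ := isCompact_Icc.exists_bound_of_continuousOn hQ
  obtain ⟨C₃, hC₃⟩ := isCompact_Icc.exists_bound_of_continuousOn hR
  obtain ⟨C₄, hC₄⟩ := isCompact_Icc.exists_bound_of_continuousOn hS
  obtain ⟨C, hC⟩ : ∃ C : NNReal, ∀ t ∈ Icc t₁ b,
      ‖P t‖ ≤ C ∧ ‖Q t‖ ≤ C ∧ ‖R t‖ ≤ C ∧ ‖S t‖ ≤ C := by
    refine ⟨NNReal.mk (|C₁| + |C₂| + |C₃| + |C₄|) (by positivity), fun t ht => ?_⟩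
    have := hC₁ t ht
    have := hC₂ t ht
    have := hC₃ t ht
    have := hC₄ t ht
    simp only [NNReal.coe_mk]
    refine ⟨?_, ?_, ?_, ?_⟩ <;>
    linarith [le_abs_self C₁, le_abs_self C₂, le_abs_self C₃, le_abs_self C₄, abs_nonneg C₁,
      abs_nonneg C₂, abs_nonneg C₃, abs_nonneg C₄]
  have hD : (0 : ℝ) < 8 * (C + 1) := by positivity
  have hδ : (0 : ℝ) < 1 / (8 * (C + 1)) := by positivity
  set δ : ℝ := 1 / (8 * (C + 1)) with hδ'
  have hCδ : C * δ ≤ 1 / 8 := by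
    rw [hδ', mul_one_div, div_le_div_iff₀ hD (by norm_num)]
    linarith
  obtain ⟨T, hT1, hT2, hT3⟩ : ∃ T, t₁ ≤ T ∧ T < t₂ ∧ t₂ - δ ≤ T :=
    ⟨max t₁ (t₂ - δ), le_max_left _ _, max_lt h₁₂ (by linarith), le_max_right _ _⟩
  obtain ⟨c, hc1, hc2, hc3⟩ : ∃ c, t₂ < c ∧ c ≤ b ∧ c ≤ t₂ + δ :=
    ⟨min b (t₂ + δ), lt_min h₂b (by linarith), min_le_left _ _, min_le_right _ _⟩
  have hsub : Icc T c ⊆ Icc t₁ b := Icc_subset_Icc hT1 hc2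
  obtain ⟨α, hα0, hα⟩ := exists_hasDerivWithinAt_of_lipschitzWith
    (f := fun t (z : A × A) => (P t * z.1 + Q t * z.2, R t * z.1 + S t * z.2))
    (a := T) (b := c) (K := 2 * C) (by linarith)
    (fun t ht => by
      obtain ⟨h1, h2, h3, h4⟩ := hC t (hsub ht)
      exact lipschitzWith_linearSystem h1 h2 h3 h4)
    (fun t ht => by simp)
    (fun x => ((hP.mono hsub).mul continuousOn_const |>.add
      ((hQ.mono hsub).mul continuousOn_const)).prodMk
      ((hR.mono hsub).mul continuousOn_const |>.add ((hS.mono hsub).mul continuousOn_const)))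
    (by
      have : c - T ≤ 2 * δ := by linarith
      have h2 : (C : ℝ) * (c - T) ≤ C * (2 * δ) := mul_le_mul_of_nonneg_left this C.2
      push_cast
      linarith) ((1 : A), Y T)
  have hΦ : ∀ t ∈ Icc T c, HasDerivWithinAt (fun t => (α t).1)
      (P t * (α t).1 + Q t * (α t).2) (Icc T c) t := fun t ht =>
    (ContinuousLinearMap.fst ℝ A A).hasFDerivAt.comp_hasDerivWithinAt t (hα t ht)
  have hΨ : ∀ t ∈ Icc T c, HasDerivWithinAt (fun t => (α t).2)
      (R t * (α t).1 + S t * (α t).2) (Icc T c) t := fun t ht =>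
    (ContinuousLinearMap.snd ℝ A A).hasFDerivAt.comp_hasDerivWithinAt t (hα t ht)
  refine ⟨T, ⟨hT1, hT2⟩, c, ⟨hc1, hc2⟩, fun t => (α t).1, fun t => (α t).2, by simp [hα0],
    hΦ, hΨ, fun t ht => ?_⟩
  have hs1 : Icc T t ⊆ Icc T c := Icc_subset_Icc_right (by linarith [ht.2])
  have hs2 : Icc T t ⊆ Ico t₁ t₂ := fun x hx => ⟨hT1.trans hx.1, hx.2.trans_lt ht.2⟩
  exact eq_mul_of_linearSystem (hS.mono (hs1.trans hsub)) (hQ.mono (hs1.trans hsub))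
    (fun x hx => (hY x (hs2 hx)).mono hs2) (fun x hx => (hΦ x (hs1 hx)).mono hs1)
    (fun x hx => (hΨ x (hs1 hx)).mono hs1) (by simp [hα0]) (right_mem_Icc.2 ht.1)

end Riccati

section Matrices

theorem hasDerivWithinAt_matrix_iff {Y : ℝ → Mat2} {Y' : Mat2} {s : Set ℝ} {t : ℝ} :
    HasDerivWithinAt Y Y' s t ↔
      ∀ i j, HasDerivWithinAt (fun τ => Y τ i j) (Y' i j) s t := by
  refine ⟨fun h i j => ?_, fun h => ?_⟩
  · exact (Matrix.entryLinearMap ℝ ℝ i j).toContinuousLinearMap.hasFDerivAt.comp_hasDerivWithinAt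
      t h
  · have e : ∀ M : Mat2, M = ∑ i, ∑ j, M i j • Matrix.single i j (1 : ℝ) := fun M => by
      conv_lhs => rw [Matrix.matrix_eq_sum_single M]
      simp
    have h' : HasDerivWithinAt (fun τ => ∑ i, ∑ j, Y τ i j • Matrix.single i j (1 : ℝ))
        (∑ i, ∑ j, Y' i j • Matrix.single i j (1 : ℝ)) s t :=
      HasDerivWithinAt.fun_sum fun i _ => HasDerivWithinAt.fun_sum fun j _ =>
        (h i j).smul_const _
    rw [← e] at h'
    exact h'.congr_of_eventuallyEq (.of_forall fun τ => e (Y τ)) (e (Y t))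

theorem hasDerivWithinAt_det_of_linear {Φ : ℝ → Mat2} {M : Mat2} {s : Set ℝ} {t : ℝ}
    (h : HasDerivWithinAt Φ (M * Φ t) s t) :
    HasDerivWithinAt (fun τ => (Φ τ).det) (M.trace * (Φ t).det) s t := by
  have h' := hasDerivWithinAt_matrix_iff.1 h
  simp only [Matrix.det_fin_two]
  refine (((h' 0 0).mul (h' 1 1)).sub ((h' 0 1).mul (h' 1 0))).congr_deriv ?_
  simp only [Matrix.mul_apply, Fin.sum_univ_two, Matrix.trace_fin_two]
  ring

/-- Liouville's formula for planar linear systems. -/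
theorem det_eq_exp_mul_det {Φ M : ℝ → Mat2} {G : ℝ → ℝ} {a b : ℝ}
    (hΦ : ∀ t ∈ Icc a b, HasDerivWithinAt Φ (M t * Φ t) (Icc a b) t)
    (hG : ∀ t ∈ Icc a b, HasDerivWithinAt G (M t).trace (Icc a b) t) {t : ℝ}
    (ht : t ∈ Icc a b) : (Φ t).det = Real.exp (G t - G a) * (Φ a).det := by
  have hder : ∀ t ∈ Icc a b, HasDerivWithinAt (fun τ => Real.exp (-G τ) * (Φ τ).det) 0
      (Icc a b) t := by
    intro t ht
    refine ((hG t ht).neg.exp.mul (hasDerivWithinAt_det_of_linear (hΦ t ht))).congr_deriv ?_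
    simp only [Pi.neg_apply]
    ring
  have key := constant_of_has_deriv_right_zero (fun t ht => (hder t ht).continuousWithinAt)
    (fun t ht => (hder t (Ico_subset_Icc_self ht)).mono_of_mem_nhdsWithin
      (Icc_mem_nhdsGE_of_mem ht)) t ht
  rw [sub_eq_add_neg, Real.exp_add, mul_assoc, ← key, ← mul_assoc, ← Real.exp_add]
  simp

theorem continuousOn_matrix {M : ℝ → Mat2} {s : Set ℝ}
    (h : ∀ i j, ContinuousOn (fun t => M t i j) s) : ContinuousOn M s :=
  continuousOn_pi.2 fun i => continuousOn_pi.2 (h i)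

theorem hasDerivWithinAt_integral_Icc {g : ℝ → ℝ} {a b t : ℝ} (hg : ContinuousOn g (Icc a b))
    (ht : t ∈ Icc a b) : HasDerivWithinAt (fun τ => ∫ x in a..τ, g x) (g t) (Icc a b) t := by
  have := Fact.mk ht
  exact integral_hasDerivWithinAt_right
    ((hg.mono (Icc_subset_Icc_right ht.2)).intervalIntegrable_of_Icc ht.1)
    (hg.stronglyMeasurableAtFilter_nhdsWithin measurableSet_Icc t) (hg t ht)

end Matrices

/-- Lemma 2.1: if `Y₀` solves the matrix Riccati equation `Y' + Y Q Y + Y P - S Y - R = 0`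
on `[t₁, t₂)` (`t₀ ≤ t₁ < t₂ < +∞`) and `t ↦ ∫_{t₁}^{t} tr(Q Y₀)` is bounded below on
`[t₁, t₂)`, then `[t₁, t₂)` is not the maximal existence interval: `Y₀` extends to a solution
on `[t₁, t₃)` for some `t₃ > t₂`. -/
theorem stmt2
    (t₀ t₁ t₂ : ℝ) (ht₀₁ : t₀ ≤ t₁) (ht₁₂ : t₁ < t₂)
    (P R S : ℝ → Mat2) (q : Fin 2 → ℝ → ℝ)
    (hP : ∀ i j : Fin 2, ContinuousOn (fun t => P t i j) (Ici t₀))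
    (hR : ∀ i j : Fin 2, ContinuousOn (fun t => R t i j) (Ici t₀))
    (hS : ∀ i j : Fin 2, ContinuousOn (fun t => S t i j) (Ici t₀))
    (hq : ∀ i : Fin 2, ContinuousOn (q i) (Ici t₀))
    (Q : ℝ → Mat2) (hQ : ∀ t, Q t = Matrix.diagonal (fun i => q i t))
    (Y₀ : ℝ → Mat2)
    (hY₀ : ∀ t ∈ Ico t₁ t₂, ∀ i j : Fin 2, HasDerivWithinAt (fun s => Y₀ s i j)
      ((S t * Y₀ t + R t - Y₀ t * Q t * Y₀ t - Y₀ t * P t) i j) (Ico t₁ t₂) t)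
    (hbdd : ∃ m : ℝ, ∀ t ∈ Ico t₁ t₂, m ≤ ∫ τ in t₁..t, Matrix.trace (Q τ * Y₀ τ)) :
    ∃ t₃ : ℝ, t₂ < t₃ ∧ ∃ Ytil : ℝ → Mat2,
      (∀ t ∈ Ico t₁ t₃, ∀ i j : Fin 2, HasDerivWithinAt (fun s => Ytil s i j)
        ((S t * Ytil t + R t - Ytil t * Q t * Ytil t - Ytil t * P t) i j) (Ico t₁ t₃) t) ∧
      ∀ t ∈ Ico t₁ t₂, Ytil t = Y₀ t := by
  obtain ⟨m, hm⟩ := hbdd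
  have hsub : Icc t₁ (t₂ + 1) ⊆ Ici t₀ := fun x hx => ht₀₁.trans hx.1
  have hPc : ContinuousOn P (Icc t₁ (t₂ + 1)) :=
    continuousOn_matrix fun i j => (hP i j).mono hsub
  have hRc : ContinuousOn R (Icc t₁ (t₂ + 1)) :=
    continuousOn_matrix fun i j => (hR i j).mono hsub
  have hSc : ContinuousOn S (Icc t₁ (t₂ + 1)) :=
    continuousOn_matrix fun i j => (hS i j).mono hsub
  have hQc : ContinuousOn Q (Icc t₁ (t₂ + 1)) := by
    rw [funext hQ]
    exact continuous_id.matrix_diagonal.comp_continuousOn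
      (continuousOn_pi.2 fun i => (hq i).mono hsub)
  have hY : ∀ t ∈ Ico t₁ t₂, HasDerivWithinAt Y₀
      (S t * Y₀ t + R t - Y₀ t * Q t * Y₀ t - Y₀ t * P t) (Ico t₁ t₂) t :=
    fun t ht => hasDerivWithinAt_matrix_iff.2 (hY₀ t ht)
  have hYc : ContinuousOn Y₀ (Ico t₁ t₂) := fun t ht => (hY t ht).continuousWithinAt
  obtain ⟨T, ⟨hT1, hT2⟩, c, ⟨hc1, hc2⟩, Φ, Ψ, hΦT, hΦ, hΨ, hΨY⟩ :=
    exists_linearSystem_past_endpoint ht₁₂ (by linarith) hPc hQc hRc hSc hY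
  have hdetc : ContinuousOn (fun t => (Φ t).det) (Icc T c) :=
    continuous_id.matrix_det.comp_continuousOn fun t ht => (hΦ t ht).continuousWithinAt
  have hsub₂ : Icc t₁ t₂ ⊆ Icc t₁ (t₂ + 1) := Icc_subset_Icc_right (by linarith)
  have htrP : ContinuousOn (fun t => (P t).trace) (Icc t₁ t₂) :=
    continuous_id.matrix_trace.comp_continuousOn (hPc.mono hsub₂)
  have htrQ : ContinuousOn (fun t => (Q t * Y₀ t).trace) (Ico t₁ t₂) :=
    continuous_id.matrix_trace.comp_continuousOn ((hQc.mono (Ico_subset_Icc_self.trans hsub₂)).mul hYc)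
  set F : ℝ → ℝ := fun t => ∫ τ in t₁..t, (P τ).trace
  set H : ℝ → ℝ := fun t => ∫ τ in t₁..t, (Q τ * Y₀ τ).trace
  have hFd : ∀ t ∈ Icc t₁ t₂, HasDerivWithinAt F (P t).trace (Icc t₁ t₂) t :=
    fun t ht => hasDerivWithinAt_integral_Icc htrP ht
  obtain ⟨C, hC⟩ := isCompact_Icc.exists_bound_of_continuousOn
    (fun t ht => (hFd t ht).continuousWithinAt : ContinuousOn F (Icc t₁ t₂))
  have hdet : ∀ t ∈ Ico T t₂, Real.exp (-C + m - (F T + H T)) ≤ (Φ t).det := by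
    intro t ht
    have hs1 : Icc T t ⊆ Icc T c := Icc_subset_Icc_right (by linarith [ht.2])
    have hs2 : Icc T t ⊆ Icc t₁ t := Icc_subset_Icc_left hT1
    have hs3 : Icc t₁ t ⊆ Ico t₁ t₂ := fun x hx => ⟨hx.1, hx.2.trans_lt ht.2⟩
    have htI : t ∈ Ico t₁ t₂ := ⟨hT1.trans ht.1, ht.2⟩
    have key := det_eq_exp_mul_det (M := fun t => P t + Q t * Y₀ t) (G := fun t => F t + H t)
      (a := T) (b := t) (Φ := Φ)
      (fun x hx => ((hΦ x (hs1 hx)).mono hs1).congr_deriv (by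
        rw [hΨY x ⟨hx.1, hx.2.trans_lt ht.2⟩, add_mul, mul_assoc]))
      (fun x hx => by
        rw [Matrix.trace_add]
        exact ((hFd x (Ico_subset_Icc_self (hs3 (hs2 hx)))).mono
          (hs2.trans (hs3.trans Ico_subset_Icc_self))).add
          ((hasDerivWithinAt_integral_Icc (htrQ.mono hs3) (hs2 hx)).mono hs2))
      (right_mem_Icc.2 ht.1)
    rw [key, hΦT, Matrix.det_one, mul_one]
    have h1 := (abs_le.1 (hC t (Ico_subset_Icc_self htI))).1
    have h2 : m ≤ H t := hm t htI
    exact Real.exp_le_exp.2 (by linarith)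
  have hdet₂ : 0 < (Φ t₂).det := by
    have hlim : Tendsto (fun t => (Φ t).det) (nhdsWithin t₂ (Ico T t₂)) (nhds (Φ t₂).det) :=
      (hdetc t₂ ⟨hT2.le, hc1.le⟩).mono fun x hx => ⟨hx.1, by linarith [hx.2]⟩
    have : (nhdsWithin t₂ (Ico T t₂)).NeBot := by
      rw [← mem_closure_iff_nhdsWithin_neBot, closure_Ico hT2.ne]
      exact right_mem_Icc.2 hT2.le
    exact (Real.exp_pos _).trans_le
      (ge_of_tendsto hlim (eventually_nhdsWithin_of_forall hdet))
  obtain ⟨t₃, ht₃, ht₃c, hpos⟩ : ∃ t₃, t₂ < t₃ ∧ t₃ ≤ c ∧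
      ∀ t ∈ Ico T t₃, IsUnit (Φ t) := by
    have hev : ∀ᶠ t in nhds t₂, 0 < (Φ t).det :=
      (hdetc.continuousAt (Icc_mem_nhds hT2 hc1)).eventually (lt_mem_nhds hdet₂)
    obtain ⟨l, u, ⟨hl, hu⟩, hlu⟩ := mem_nhds_iff_exists_Ioo_subset.1 hev
    refine ⟨min u c, lt_min hu hc1, min_le_right _ _, fun t ht => ?_⟩
    rw [Matrix.isUnit_iff_isUnit_det, isUnit_iff_ne_zero]
    rcases lt_or_ge t t₂ with h | h
    · exact ((Real.exp_pos _).trans_le (hdet t ⟨ht.1, h⟩)).ne'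
    · exact (hlu ⟨hl.trans_le h, ht.2.trans_le (min_le_left _ _)⟩ : 0 < (Φ t).det).ne'
  set Z : ℝ → Mat2 := fun t => if t < t₂ then Y₀ t else Ψ t * Ring.inverse (Φ t)
  have hZY : ∀ t, t < t₂ → Z t = Y₀ t := fun t ht => if_pos ht
  have hZΨ : ∀ t ∈ Ico T t₃, Z t = Ψ t * Ring.inverse (Φ t) := by
    intro t ht
    rcases lt_or_ge t t₂ with h | h
    · rw [hZY t h, hΨY t ⟨ht.1, h⟩, mul_assoc, Ring.mul_inverse_cancel _ (hpos t ht), mul_one]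
    · exact if_neg h.not_gt
  refine ⟨t₃, ht₃, Z, fun t ht => hasDerivWithinAt_matrix_iff.1 ?_, fun t ht => hZY t ht.2⟩
  rcases lt_or_ge t t₂ with h | h
  · rw [hZY t h]
    refine ((hY t ⟨ht.1, h⟩).congr (fun x hx => hZY x hx.2) (hZY t h)).mono_of_mem_nhdsWithin ?_
    filter_upwards [self_mem_nhdsWithin, mem_nhdsWithin_of_mem_nhds (Iio_mem_nhds h)] with x hx hx'
    exact ⟨hx.1, hx'⟩
  · have hTt : T < t := hT2.trans_le h
    have htT : t ∈ Ico T t₃ := ⟨hTt.le, ht.2⟩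
    have hs : Ico T t₃ ⊆ Icc T c := fun x hx => ⟨hx.1, hx.2.le.trans ht₃c⟩
    rw [hZΨ t htT]
    refine ((hasDerivWithinAt_mul_ringInverse ((hΦ t (hs htT)).mono hs) ((hΨ t (hs htT)).mono hs)
      (hpos t htT)).congr hZΨ (hZΨ t htT)).mono_of_mem_nhdsWithin ?_
    filter_upwards [self_mem_nhdsWithin, mem_nhdsWithin_of_mem_nhds (Ioi_mem_nhds hTt)]
      with x hx hx'
    exact ⟨le_of_lt hx', hx.2⟩
end
end

section
/- (Theorem 2.1, scalar Riccati comparison) Let a(t), b(t), c(t), c₁(t) be continuously differentiable real functions on [t₀, +∞). Suppose the equation y' + a(t) y² + b(t) y + c₁(t) = 0 has a solution y₁ on [t₁, t₂) (t₀ ≤ t₁ < t₂ ≤ +∞), and that a(t) ≥ 0 and c(t) ≤ c₁(t) for all t ∈ [t₁, t₂). Then for each real number y₍₀₎ ≥ y₁(t₁), the equation y' + a(t) y² + b(t) y + c(t) = 0 has a solution y₀ on [t₁, t₂) with y₀(t₁) = y₍₀₎ and y₀(t) ≥ y₁(t) for all t ∈ [t₁, t₂). -/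
open Set Filter MeasureTheory intervalIntegral

noncomputable section

open scoped NNReal Topology

/-- Restrict a derivative within `[s, T]` to a right derivative at a point of `[s, T)`. -/
theorem HasDerivWithinAt.Ici_of_Icc {f : ℝ → ℝ} {f' s T t : ℝ}
    (h : HasDerivWithinAt f f' (Icc s T) t) (ht : t ∈ Ico s T) :
    HasDerivWithinAt f f' (Ici t) t :=
  h.mono_of_mem_nhdsWithin (Icc_mem_nhdsGE_of_mem ht)

/-- A vector field on the line that is bounded and globally Lipschitz in space, and continuous in
time on `[s, T]`, has an integral curve defined on all of `[s, T]`. -/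
theorem exists_hasDerivWithinAt_Icc_of_lipschitz_of_bounded {f : ℝ → ℝ → ℝ} {s T : ℝ} (hsT : s ≤ T)
    {K L : ℝ≥0} (hlip : ∀ t ∈ Icc s T, LipschitzWith K (f t))
    (hcont : ∀ x, ContinuousOn (f · x) (Icc s T))
    (hbound : ∀ t ∈ Icc s T, ∀ x, ‖f t x‖ ≤ L) (x₀ : ℝ) :
    ∃ u : ℝ → ℝ, u s = x₀ ∧
      ∀ t ∈ Icc s T, HasDerivWithinAt u (f t (u t)) (Icc s T) t := by
  have hpl : IsPicardLindelof f (⟨s, left_mem_Icc.2 hsT⟩ : Icc s T) x₀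
      (L * (T - s).toNNReal) 0 L K :=
    { lipschitzOnWith := fun t ht => (hlip t ht).lipschitzOnWith
      continuousOn := fun x _ => hcont x
      norm_le := fun t ht x _ => hbound t ht x
      mul_max_le := by
        have h : 0 ≤ T - s := sub_nonneg.2 hsT
        simp [h] }
  exact hpl.exists_eq_forall_mem_Icc_hasDerivWithinAt₀

/-- The equation `u' = -(A u² + B u) + C` with `A, C ≥ 0` has a nonnegative solution on `[s, T]`
for every nonnegative initial value. -/
theorem exists_nonneg_riccati_Icc {A B C : ℝ → ℝ} {s T : ℝ} (hsT : s ≤ T)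
    (hA : ContinuousOn A (Icc s T)) (hB : ContinuousOn B (Icc s T)) (hC : ContinuousOn C (Icc s T))
    (hA0 : ∀ t ∈ Icc s T, 0 ≤ A t) (hC0 : ∀ t ∈ Icc s T, 0 ≤ C t) {x₀ : ℝ} (hx₀ : 0 ≤ x₀) :
    ∃ u : ℝ → ℝ, u s = x₀ ∧
      (∀ t ∈ Icc s T, HasDerivWithinAt u (-(A t * u t ^ 2 + B t * u t) + C t) (Icc s T) t) ∧
      ∀ t ∈ Icc s T, 0 ≤ u t := by
  obtain ⟨KA, hKA⟩ := isCompact_Icc.exists_bound_of_continuousOn hA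
  obtain ⟨KB, hKB⟩ := isCompact_Icc.exists_bound_of_continuousOn hB
  obtain ⟨KC, hKC⟩ := isCompact_Icc.exists_bound_of_continuousOn hC
  simp only [Real.norm_eq_abs] at hKA hKB hKC
  obtain ⟨K, hK1, hKA', hKB', hKC'⟩ : ∃ K, 1 ≤ K ∧ KA ≤ K ∧ KB ≤ K ∧ KC ≤ K :=
    ⟨max 1 (max KA (max KB KC)), by simp, by simp, by simp, by simp⟩
  replace hKA := fun t ht => (hKA t ht).trans hKA'
  replace hKB := fun t ht => (hKB t ht).trans hKB'
  replace hKC := fun t ht => (hKC t ht).trans hKC'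
  let M : ℝ := (x₀ + 1) * Real.exp (3 * K * (T - s))
  have hM : 0 < M := by positivity
  -- The nonlinearity is truncated to `[0, M]`, where `M` bounds every solution on `[s, T]`.
  let φ : ℝ → ℝ := fun x => max 0 (min x M)
  have hφ0 : ∀ x, 0 ≤ φ x := fun x => le_max_left _ _
  have hφM : ∀ x, φ x ≤ M := fun x => max_le hM.le (min_le_right _ _)
  have hφl : ∀ x y, |φ x - φ y| ≤ |x - y| := fun x y =>
    (by simpa [φ, max_comm] using abs_max_sub_max_le_abs (min x M) (min y M) 0 :
      |φ x - φ y| ≤ |min x M - min y M|).trans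
      (abs_min_sub_min_le_max x M y M |>.trans (by simp))
  let f : ℝ → ℝ → ℝ := fun t x => -(A t * φ x ^ 2 + B t * φ x) + C t
  obtain ⟨u, hus, hu⟩ := exists_hasDerivWithinAt_Icc_of_lipschitz_of_bounded (f := f) hsT
    (K := (2 * K * M + K).toNNReal) (L := (K * M ^ 2 + K * M + K).toNNReal)
    (by
      intro t ht
      refine LipschitzWith.of_dist_le_mul fun x y => ?_
      rw [Real.dist_eq, Real.dist_eq, Real.coe_toNNReal _ (by positivity)]
      have h1 : f t x - f t y = -((A t * (φ x + φ y) + B t) * (φ x - φ y)) := by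
        simp only [f]; ring
      rw [h1, abs_neg, abs_mul]
      have h2 : |A t * (φ x + φ y) + B t| ≤ 2 * K * M + K := by
        refine (abs_add_le _ _).trans (add_le_add ?_ (hKB t ht))
        rw [abs_mul, abs_of_nonneg (add_nonneg (hφ0 x) (hφ0 y))]
        have := mul_le_mul (hKA t ht) (add_le_add (hφM x) (hφM y))
          (add_nonneg (hφ0 x) (hφ0 y)) (by positivity)
        linarith
      exact mul_le_mul h2 (hφl x y) (abs_nonneg _) (by positivity))
    (fun x => by fun_prop)
    (by
      intro t ht x
      rw [Real.norm_eq_abs, Real.coe_toNNReal _ (by positivity)]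
      refine (abs_add_le _ _).trans (add_le_add ?_ (hKC t ht))
      rw [abs_neg]
      refine (abs_add_le _ _).trans (add_le_add ?_ ?_)
      · rw [abs_mul, abs_of_nonneg (sq_nonneg (φ x))]
        exact mul_le_mul (hKA t ht) (pow_le_pow_left₀ (hφ0 x) (hφM x) 2) (sq_nonneg _)
          (by positivity)
      · rw [abs_mul, abs_of_nonneg (hφ0 x)]
        exact mul_le_mul (hKB t ht) (hφM x) (hφ0 x) (by positivity))
    x₀
  have hucont : ContinuousOn u (Icc s T) := fun t ht => (hu t ht).continuousWithinAt
  have hupos : ∀ t ∈ Icc s T, 0 ≤ u t := by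
    intro t ht
    refine le_of_forall_pos_le_add fun ε hε => ?_
    have hden : 0 < T - s + 1 := by linarith
    let δ := ε / (T - s + 1)
    have hδ : 0 < δ := by positivity
    have key : -u t ≤ δ * (t - s + 1) :=
      image_le_of_deriv_right_lt_deriv_boundary (f := fun t => -u t)
        (B := fun t => δ * (t - s + 1)) (B' := fun _ => δ)
        hucont.neg (fun x hx => ((hu x (Ico_subset_Icc_self hx)).Ici_of_Icc hx).neg)
        (by rw [hus, sub_self]; linarith)
        (fun x => by simpa using (((hasDerivAt_id x).sub_const s).add_const 1).const_mul δ)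
        (by
          intro x hx hux
          have hneg : u x ≤ 0 := by
            have : 0 ≤ δ * (x - s + 1) := mul_nonneg hδ.le (by linarith [hx.1])
            linarith
          have hφ : φ (u x) = 0 := max_eq_left ((min_le_left _ _).trans hneg)
          have := hC0 x (Ico_subset_Icc_self hx)
          simp only [f, hφ]
          linarith) ht
    have : δ * (t - s + 1) ≤ δ * (T - s + 1) :=
      mul_le_mul_of_nonneg_left (by linarith [ht.2]) hδ.le
    have : δ * (T - s + 1) = ε := div_mul_cancel₀ _ hden.ne'
    linarith
  have huM : ∀ t ∈ Icc s T, u t ≤ M := by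
    intro t ht
    have key : u t ≤ (x₀ + 1) * Real.exp (3 * K * (t - s)) :=
      image_le_of_deriv_right_lt_deriv_boundary
        (B := fun t => (x₀ + 1) * Real.exp (3 * K * (t - s)))
        (B' := fun t => (x₀ + 1) * (Real.exp (3 * K * (t - s)) * (3 * K)))
        hucont (fun x hx => (hu x (Ico_subset_Icc_self hx)).Ici_of_Icc hx)
        (by simp [hus])
        (fun x => by
          simpa using ((((hasDerivAt_id x).sub_const s).const_mul (3 * K)).exp).const_mul (x₀ + 1))
        (by
          intro x hx hux
          have hx' := Ico_subset_Icc_self hx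
          have hu1 : 1 ≤ u x := by
            rw [hux]
            have : 1 ≤ Real.exp (3 * K * (x - s)) :=
              Real.one_le_exp (mul_nonneg (by positivity) (by linarith [hx.1]))
            nlinarith
          have hφu : φ (u x) ≤ u x := max_le (by linarith) (min_le_left _ _)
          have h1 : 0 ≤ A x * φ (u x) ^ 2 := mul_nonneg (hA0 x hx') (sq_nonneg _)
          have h2 : -B x * φ (u x) ≤ K * u x :=
            mul_le_mul ((neg_le_abs _).trans (hKB x hx')) hφu (hφ0 _) (by positivity)
          have h3 : C x ≤ K := (le_abs_self _).trans (hKC x hx')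
          have h4 : (x₀ + 1) * (Real.exp (3 * K * (x - s)) * (3 * K)) = 3 * K * u x := by
            rw [hux]; ring
          simp only [f]
          rw [h4]
          nlinarith) ht
    refine key.trans (mul_le_mul_of_nonneg_left (Real.exp_le_exp.2 ?_) (by positivity))
    exact mul_le_mul_of_nonneg_left (by linarith [ht.2]) (by positivity)
  refine ⟨u, hus, fun t ht => ?_, hupos⟩
  have hφ : φ (u t) = u t := by simp [φ, huM t ht, hupos t ht]
  simpa only [f, hφ] using hu t ht

/-- Solutions of a Riccati equation with continuous coefficients are determined by their
initial value. -/
theorem riccati_eqOn_Icc {a b c y z : ℝ → ℝ} {s T : ℝ}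
    (ha : ContinuousOn a (Icc s T)) (hb : ContinuousOn b (Icc s T))
    (hy : ∀ t ∈ Icc s T, HasDerivWithinAt y (-(a t * y t ^ 2 + b t * y t + c t)) (Icc s T) t)
    (hz : ∀ t ∈ Icc s T, HasDerivWithinAt z (-(a t * z t ^ 2 + b t * z t + c t)) (Icc s T) t)
    (hs : y s = z s) : EqOn y z (Icc s T) := by
  have hyc : ContinuousOn y (Icc s T) := fun t ht => (hy t ht).continuousWithinAt
  have hzc : ContinuousOn z (Icc s T) := fun t ht => (hz t ht).continuousWithinAt
  obtain ⟨K, hK⟩ := isCompact_Icc.exists_bound_of_continuousOn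
    (show ContinuousOn (fun t => a t * (y t + z t) + b t) (Icc s T) by fun_prop)
  intro t ht
  refine sub_eq_zero.1 (eq_zero_of_abs_deriv_le_mul_abs_self_of_eq_zero_right
    (f := fun t => y t - z t) (K := K)
    (hyc.sub hzc) (fun x hx => (((hy x (Ico_subset_Icc_self hx)).sub
      (hz x (Ico_subset_Icc_self hx))).Ici_of_Icc hx)) (sub_eq_zero.2 hs) (fun x hx => ?_) t ht)
  rw [show -(a x * y x ^ 2 + b x * y x + c x) - -(a x * z x ^ 2 + b x * z x + c x) =
    -((a x * (y x + z x) + b x) * (y x - z x)) by ring, norm_neg, norm_mul]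
  exact mul_le_mul_of_nonneg_right (hK x (Ico_subset_Icc_self hx)) (norm_nonneg _)

/-- Theorem 2.1 (scalar Riccati comparison): if `y' + a y² + b y + c₁ = 0` has a solution `y₁`
on `[t₁, t₂)` (`t₀ ≤ t₁ < t₂ ≤ +∞`), `a ≥ 0` and `c ≤ c₁` on `[t₁, t₂)`, then for every
`y₍₀₎ ≥ y₁(t₁)` the equation `y' + a y² + b y + c = 0` has a solution `y₀` on `[t₁, t₂)` with
`y₀(t₁) = y₍₀₎` and `y₀ ≥ y₁` on `[t₁, t₂)`. -/
theorem stmt3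
    (t₀ t₁ : ℝ) (t₂ : EReal) (ht₀₁ : t₀ ≤ t₁) (ht₁₂ : (t₁ : EReal) < t₂)
    (a b c c₁ : ℝ → ℝ)
    (ha : ContDiffOn ℝ 1 a (Ici t₀)) (hb : ContDiffOn ℝ 1 b (Ici t₀))
    (hc : ContDiffOn ℝ 1 c (Ici t₀)) (hc₁ : ContDiffOn ℝ 1 c₁ (Ici t₀))
    (J : Set ℝ) (hJ : J = {t : ℝ | t₁ ≤ t ∧ (t : EReal) < t₂})
    (y₁ : ℝ → ℝ)
    (hy₁ : ∀ t ∈ J, HasDerivWithinAt y₁ (-(a t * y₁ t ^ 2 + b t * y₁ t + c₁ t)) J t)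
    (hanneg : ∀ t ∈ J, 0 ≤ a t) (hcc₁ : ∀ t ∈ J, c t ≤ c₁ t)
    (y00 : ℝ) (hy00 : y₁ t₁ ≤ y00) :
    ∃ y₀ : ℝ → ℝ,
      (∀ t ∈ J, HasDerivWithinAt y₀ (-(a t * y₀ t ^ 2 + b t * y₀ t + c t)) J t) ∧
      y₀ t₁ = y00 ∧ ∀ t ∈ J, y₁ t ≤ y₀ t := by
  subst hJ
  set J : Set ℝ := {t : ℝ | t₁ ≤ t ∧ (t : EReal) < t₂}
  have hsub : ∀ T ∈ J, Icc t₁ T ⊆ J := fun T hT t ht =>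
    ⟨ht.1, (EReal.coe_le_coe_iff.2 ht.2).trans_lt hT.2⟩
  have hJt₀ : J ⊆ Ici t₀ := fun t ht => ht₀₁.trans ht.1
  have haJ : ContinuousOn a J := ha.continuousOn.mono hJt₀
  have hbJ : ContinuousOn b J := hb.continuousOn.mono hJt₀
  have hcJ : ContinuousOn c J := hc.continuousOn.mono hJt₀
  have hc₁J : ContinuousOn c₁ J := hc₁.continuousOn.mono hJt₀
  have hy₁J : ContinuousOn y₁ J := fun t ht => (hy₁ t ht).continuousWithinAt
  have hsol : ∀ T ∈ J, ∃ y : ℝ → ℝ,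
      (∀ t ∈ Icc t₁ T,
        HasDerivWithinAt y (-(a t * y t ^ 2 + b t * y t + c t)) (Icc t₁ T) t) ∧
      y t₁ = y00 ∧ ∀ t ∈ Icc t₁ T, y₁ t ≤ y t := by
    intro T hT
    obtain ⟨u, hus, hu, hu0⟩ := exists_nonneg_riccati_Icc (A := a)
      (B := fun t => 2 * a t * y₁ t + b t) (C := fun t => c₁ t - c t) hT.1
      (haJ.mono (hsub T hT)) (ContinuousOn.mono (by fun_prop) (hsub T hT))
      (ContinuousOn.mono (by fun_prop) (hsub T hT))
      (fun t ht => hanneg t (hsub T hT ht))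
      (fun t ht => sub_nonneg.2 (hcc₁ t (hsub T hT ht))) (sub_nonneg.2 hy00)
    refine ⟨fun t => y₁ t + u t, fun t ht => ?_, by simp [hus],
      fun t ht => le_add_of_nonneg_right (hu0 t ht)⟩
    exact (((hy₁ t (hsub T hT ht)).mono (hsub T hT)).add (hu t ht)).congr_deriv (by ring)
  have hnext : ∀ t : ℝ, ∃ T : ℝ, t ∈ J → T ∈ J ∧ t < T := by
    intro t
    by_cases ht : t ∈ J
    · obtain ⟨T, hT₁, hT₂⟩ := EReal.lt_iff_exists_real_btwn.1 ht.2
      have hT₁' : t < T := EReal.coe_lt_coe_iff.1 hT₁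
      exact ⟨T, fun _ => ⟨⟨ht.1.trans hT₁'.le, hT₂⟩, hT₁'⟩⟩
    · exact ⟨t, fun h => absurd h ht⟩
  choose! y hy hyt₁ hyge using hsol
  choose T hT using hnext
  have hagree : ∀ S ∈ J, ∀ S' ∈ J, S ≤ S' → EqOn (y S) (y S') (Icc t₁ S) := by
    intro S hS S' hS' hSS'
    have hI : Icc t₁ S ⊆ Icc t₁ S' := Icc_subset_Icc_right hSS'
    exact riccati_eqOn_Icc (haJ.mono (hsub S hS)) (hbJ.mono (hsub S hS)) (hy S hS)
      (fun t ht => (hy S' hS' t (hI ht)).mono hI) ((hyt₁ S hS).trans (hyt₁ S' hS').symm)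
  have hglue : ∀ S ∈ J, EqOn (fun t => y (T t) t) (y S) (Icc t₁ S) := by
    intro S hS t ht
    obtain ⟨hTJ, htT⟩ := hT t (hsub S hS ht)
    rcases le_total (T t) S with h | h
    · exact hagree _ hTJ S hS h ⟨ht.1, htT.le⟩
    · exact (hagree S hS _ hTJ h ht).symm
  refine ⟨fun t => y (T t) t, fun t ht => ?_, ?_, fun t ht => ?_⟩
  · obtain ⟨hTJ, htT⟩ := hT t ht
    have htI : t ∈ Icc t₁ (T t) := ⟨ht.1, htT.le⟩
    have hmem : Icc t₁ (T t) ∈ 𝓝[J] t :=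
      mem_of_superset (inter_mem_nhdsWithin J (Iio_mem_nhds htT)) fun x hx => ⟨hx.1.1, hx.2.le⟩
    exact ((hy _ hTJ t htI).congr (hglue _ hTJ) rfl).mono_of_mem_nhdsWithin hmem
  · exact hyt₁ _ (hT t₁ ⟨le_rfl, ht₁₂⟩).1
  · obtain ⟨hTJ, htT⟩ := hT t ht
    exact hyge _ hTJ t ⟨ht.1, htT.le⟩
end
end

section
/- (Lemma 2.3) Let a(t), b(t), c(t) be continuously differentiable real functions on [t₀, +∞). Suppose the equation y' + a(t) y² + b(t) y + c(t) = 0 has a solution on [t₁, +∞) for some t₁ ≥ t₀, that a(t) ≥ 0 and c(t) ≥ 0 for all t ≥ t₀, and that ∫_{t₀}^{+∞} a(τ) exp{−∫_{t₀}^{τ} b(s) ds} dτ = +∞. Then the equation y' + a(t) y² + b(t) y + c(t) = 0 has a positive solution on [t₁, +∞). -/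
open Set Filter MeasureTheory intervalIntegral

noncomputable section

/-- The fundamental theorem of calculus on a closed half-line, including its endpoint. -/
theorem hasDerivWithinAt_integral_Ici {f : ℝ → ℝ} {p : ℝ} (hf : ContinuousOn f (Ici p))
    {t : ℝ} (ht : t ∈ Ici p) :
    HasDerivWithinAt (fun x => ∫ s in p..x, f s) (f t) (Ici p) t := by
  have hg : Continuous fun x => f (max p x) :=
    hf.comp_continuous (by fun_prop) fun x => le_max_left p x
  have heq : ∀ x ∈ Ici p, ∫ s in p..x, f s = ∫ s in p..x, f (max p s) := by
    intro x hx
    refine intervalIntegral.integral_congr fun s hs => ?_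
    rw [uIcc_of_le hx] at hs
    simp only [max_eq_right hs.1]
  have h := (hg.integral_hasStrictDerivAt p t).hasDerivAt.hasDerivWithinAt (s := Ici p)
  rw [max_eq_right (mem_Ici.mp ht)] at h
  exact h.congr heq (heq t ht)

/-- A function with nonnegative derivative on a closed half-line is monotone there. -/
theorem monotoneOn_Ici_of_hasDerivWithinAt_nonneg {f f' : ℝ → ℝ} {p : ℝ}
    (hf : ∀ t ∈ Ici p, HasDerivWithinAt f (f' t) (Ici p) t) (hf' : ∀ t ∈ Ici p, 0 ≤ f' t) :
    MonotoneOn f (Ici p) := by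
  refine monotoneOn_of_hasDerivWithinAt_nonneg (f' := f') (convex_Ici p)
    (fun t ht => (hf t ht).continuousWithinAt) (fun t ht => ?_) fun t ht => ?_
  · exact (hf t (interior_subset ht)).mono interior_subset
  · exact hf' t (interior_subset ht)

/-- A solution of `z' = -(A z² + C)` with `A, C ≥ 0` and `A` having divergent integral
is nonnegative. -/
theorem nonneg_of_hasDerivWithinAt_riccati {z A C I : ℝ → ℝ} {p : ℝ}
    (hz : ∀ t ∈ Ici p, HasDerivWithinAt z (-(A t * z t ^ 2 + C t)) (Ici p) t)
    (hI : ∀ t ∈ Ici p, HasDerivWithinAt I (A t) (Ici p) t)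
    (hA : ∀ t ∈ Ici p, 0 ≤ A t) (hC : ∀ t ∈ Ici p, 0 ≤ C t) (hdiv : Tendsto I atTop atTop)
    {T : ℝ} (hT : T ∈ Ici p) : 0 ≤ z T := by
  by_contra! hneg
  have hmono : MonotoneOn (fun t => -z t) (Ici p) := by
    refine monotoneOn_Ici_of_hasDerivWithinAt_nonneg (fun t ht => (hz t ht).neg) fun t ht => ?_
    have := hA t ht
    have := hC t ht
    rw [neg_neg]
    positivity
  have hsub : Ici T ⊆ Ici p := Ici_subset_Ici.mpr hT
  have hzneg : ∀ t ∈ Ici T, z t < 0 := by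
    intro t ht
    have h := hmono hT (hsub ht) ht
    simp only at h
    linarith
  have hG : MonotoneOn (fun t => (z t)⁻¹ - I t) (Ici T) := by
    refine monotoneOn_Ici_of_hasDerivWithinAt_nonneg (fun t ht =>
      (((hz t (hsub ht)).mono hsub).fun_inv (hzneg t ht).ne).sub ((hI t (hsub ht)).mono hsub))
      fun t ht => ?_
    have hne := (hzneg t ht).ne
    have h := hC t (hsub ht)
    have : -(-(A t * z t ^ 2 + C t)) / z t ^ 2 - A t = C t / z t ^ 2 := by
      field_simp
      ring
    rw [this]
    positivity
  obtain ⟨t, hIt, hTt⟩ :=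
    ((hdiv.eventually_gt_atTop (I T - (z T)⁻¹)).and (eventually_ge_atTop T)).exists
  have h := hG self_mem_Ici hTt hTt
  have h' := inv_lt_zero.mpr (hzneg t hTt)
  simp only at h
  linarith

/-- The equation `u' = -(a u² + q u)` with `a ≥ 0` has a positive solution on a half-line. -/
theorem exists_pos_hasDerivWithinAt_bernoulli {a q : ℝ → ℝ} {p : ℝ}
    (ha : ContinuousOn a (Ici p)) (hq : ContinuousOn q (Ici p)) (hnonneg : ∀ t ∈ Ici p, 0 ≤ a t) :
    ∃ u : ℝ → ℝ, (∀ t ∈ Ici p, HasDerivWithinAt u (-(a t * u t ^ 2 + q t * u t)) (Ici p) t) ∧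
      ∀ t ∈ Ici p, 0 < u t := by
  set F : ℝ → ℝ := fun t => Real.exp (-∫ s in p..t, q s) with hFdef
  have hF : ∀ t ∈ Ici p, HasDerivWithinAt F (F t * -q t) (Ici p) t := fun t ht =>
    (hasDerivWithinAt_integral_Ici hq ht).fun_neg.exp
  have hFpos : ∀ t, 0 < F t := fun t => Real.exp_pos _
  have haF : ContinuousOn (fun t => a t * F t) (Ici p) :=
    ha.mul fun t ht => (hF t ht).continuousWithinAt
  have hD : ∀ t ∈ Ici p, 0 < 1 + ∫ s in p..t, a s * F s := by
    intro t ht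
    have : 0 ≤ ∫ s in p..t, a s * F s :=
      intervalIntegral.integral_nonneg ht fun s hs => mul_nonneg (hnonneg s hs.1) (hFpos s).le
    linarith
  refine ⟨fun t => F t / (1 + ∫ s in p..t, a s * F s), fun t ht => ?_,
    fun t ht => div_pos (hFpos t) (hD t ht)⟩
  have hne := (hD t ht).ne'
  refine ((hF t ht).fun_div ((hasDerivWithinAt_integral_Ici haF ht).const_add 1) hne).congr_deriv ?_
  field_simp
  ring

/-- Lemma 2.3: if `y' + a y² + b y + c = 0` has a solution on `[t₁, +∞)` for some `t₁ ≥ t₀`,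
`a ≥ 0` and `c ≥ 0` on `[t₀, +∞)`, and `∫_{t₀}^{+∞} a(τ) exp{-∫_{t₀}^{τ} b} dτ = +∞`,
then `y' + a y² + b y + c = 0` has a positive solution on `[t₁, +∞)`. -/
theorem stmt5
    (t₀ t₁ : ℝ) (ht₀₁ : t₀ ≤ t₁)
    (a b c : ℝ → ℝ)
    (ha : ContDiffOn ℝ 1 a (Ici t₀)) (hb : ContDiffOn ℝ 1 b (Ici t₀))
    (hc : ContDiffOn ℝ 1 c (Ici t₀))
    (hsol : ∃ y : ℝ → ℝ, ∀ t ∈ Ici t₁,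
      HasDerivWithinAt y (-(a t * y t ^ 2 + b t * y t + c t)) (Ici t₁) t)
    (hanneg : ∀ t ≥ t₀, 0 ≤ a t) (hcnneg : ∀ t ≥ t₀, 0 ≤ c t)
    (hdiv : Tendsto (fun T => ∫ τ in t₀..T, a τ * Real.exp (-∫ s in t₀..τ, b s))
      atTop atTop) :
    ∃ y : ℝ → ℝ,
      (∀ t ∈ Ici t₁, HasDerivWithinAt y (-(a t * y t ^ 2 + b t * y t + c t)) (Ici t₁) t) ∧
      ∀ t ∈ Ici t₁, 0 < y t := by
  obtain ⟨y, hy⟩ := hsol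
  have hsub : Ici t₁ ⊆ Ici t₀ := Ici_subset_Ici.mpr ht₀₁
  have hyc : ContinuousOn y (Ici t₁) := fun t ht => (hy t ht).continuousWithinAt
  have hynonneg : ∀ t ∈ Ici t₁, 0 ≤ y t := by
    set B : ℝ → ℝ := fun t => ∫ s in t₀..t, b s with hBdef
    have hB : ∀ t ∈ Ici t₀, HasDerivWithinAt B (b t) (Ici t₀) t := fun t ht =>
      hasDerivWithinAt_integral_Ici hb.continuousOn ht
    have haE : ContinuousOn (fun t => a t * Real.exp (-B t)) (Ici t₀) :=
      ha.continuousOn.mul fun t ht => (hB t ht).fun_neg.exp.continuousWithinAt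
    intro T hT
    have h := nonneg_of_hasDerivWithinAt_riccati (z := fun t => y t * Real.exp (B t))
      (C := fun t => c t * Real.exp (B t)) (p := t₁) (fun t ht => ?_)
      (fun t ht => (hasDerivWithinAt_integral_Ici haE (hsub ht)).mono hsub)
      (fun t ht => mul_nonneg (hanneg t (hsub ht)) (Real.exp_pos _).le)
      (fun t ht => mul_nonneg (hcnneg t (hsub ht)) (Real.exp_pos _).le) hdiv hT
    · exact nonneg_of_mul_nonneg_left h (Real.exp_pos _)
    · refine ((hy t ht).fun_mul ((hB t (hsub ht)).mono hsub).exp).congr_deriv ?_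
      rw [Real.exp_neg]
      field_simp
      ring
  obtain ⟨u, hu, hupos⟩ := exists_pos_hasDerivWithinAt_bernoulli
    (q := fun t => b t + 2 * a t * y t) (ha.continuousOn.mono hsub)
    ((hb.continuousOn.mono hsub).add
      ((continuousOn_const.mul (ha.continuousOn.mono hsub)).mul hyc))
    fun t ht => hanneg t (hsub ht)
  refine ⟨fun t => y t + u t, fun t ht => ?_,
    fun t ht => add_pos_of_nonneg_of_pos (hynonneg t ht) (hupos t ht)⟩
  refine ((hy t ht).fun_add (hu t ht)).congr_deriv ?_
  ring
end
end

section
/- (Core lemma of the proof of Corollary 3.2) Let p, q, F, s be continuous real functions on [t₀, +∞) and let t₀ ≤ t₁ < t₂ < +∞. Suppose ∫_{t₁}^{t₂} min[ q(τ) exp{−∫_{t₁}^{τ} (p(ζ) − s(ζ)) dζ}, −F(τ) exp{∫_{t₁}^{τ} (p(ζ) − s(ζ)) dζ} ] dτ ≥ π. Then for every nontrivial solution (φ, ψ) of the scalar system φ' = p(t)φ + q(t)ψ, ψ' = F(t)φ + s(t)ψ on [t₀, +∞), the function φ has at least one zero on [t₁, t₂]. -/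
open Set Filter MeasureTheory intervalIntegral

noncomputable section

/-- A function continuous on `[a, +∞)` extends continuously to `ℝ` by a constant. -/
lemma ContinuousOn.comp_max_Ici {f : ℝ → ℝ} {a : ℝ} (hf : ContinuousOn f (Ici a)) :
    Continuous fun x => f (max a x) :=
  hf.comp_continuous (by fun_prop) fun x => le_max_left a x

/-- If `z` solves the Riccati equation `z' = c - b z²` on `[t₁, t₂]` and `m ≤ min b (-c)`, then
`∫ m < π`. -/
lemma integral_lt_pi_of_riccati {t₁ t₂ : ℝ} (h : t₁ ≤ t₂) {z b c m : ℝ → ℝ}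
    (hm : Continuous m) (hzc : ContinuousOn z (Icc t₁ t₂))
    (hz : ∀ t ∈ Ioo t₁ t₂, HasDerivAt z (c t - b t * z t ^ 2) t)
    (hmb : ∀ t ∈ Ioo t₁ t₂, m t ≤ b t) (hmc : ∀ t ∈ Ioo t₁ t₂, m t ≤ -c t) :
    ∫ τ in t₁..t₂, m τ < Real.pi := by
  have hprim : ∀ t, HasDerivAt (fun x => ∫ τ in t₁..x, m τ) (m t) t := fun t =>
    hm.integral_hasStrictDerivAt t₁ t |>.hasDerivAt
  have hanti : AntitoneOn (fun t => Real.arctan (z t) + ∫ τ in t₁..t, m τ) (Icc t₁ t₂) := by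
    refine antitoneOn_of_hasDerivWithinAt_nonpos (convex_Icc t₁ t₂)
      (f' := fun t => 1 / (1 + z t ^ 2) * (c t - b t * z t ^ 2) + m t) ?_ ?_ ?_
    · exact (Real.continuous_arctan.comp_continuousOn hzc).add
        fun t _ => (hprim t).continuousAt.continuousWithinAt
    · rw [interior_Icc]
      exact fun t ht => ((hz t ht).arctan.add (hprim t)).hasDerivWithinAt
    · rw [interior_Icc]
      intro t ht
      have hpos : 0 < 1 + z t ^ 2 := by positivity
      have hle : c t - b t * z t ^ 2 ≤ -m t * (1 + z t ^ 2) := by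
        nlinarith [hmc t ht, mul_le_mul_of_nonneg_right (hmb t ht) (sq_nonneg (z t))]
      have hdiv := (div_le_iff₀ hpos).2 hle
      rw [one_div_mul_eq_div]
      linarith
  have hcmp := hanti (left_mem_Icc.2 h) (right_mem_Icc.2 h) h
  simp only [integral_same, add_zero] at hcmp
  linarith [Real.arctan_lt_pi_div_two (z t₁), Real.neg_pi_div_two_lt_arctan (z t₂)]

/-- Core lemma of the proof of Corollary 3.2: if
`∫_{t₁}^{t₂} min[q(τ) e^{-∫_{t₁}^{τ}(p - s)}, -F(τ) e^{∫_{t₁}^{τ}(p - s)}] dτ ≥ π`,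
then for every nontrivial solution `(φ, ψ)` of the system
`φ' = p φ + q ψ`, `ψ' = F φ + s ψ` on `[t₀, +∞)`, the function `φ` has a zero on `[t₁, t₂]`. -/
theorem stmt15
    (t₀ t₁ t₂ : ℝ) (ht₀₁ : t₀ ≤ t₁) (ht₁₂ : t₁ < t₂)
    (p q F s : ℝ → ℝ)
    (hp : ContinuousOn p (Ici t₀)) (hq : ContinuousOn q (Ici t₀))
    (hF : ContinuousOn F (Ici t₀)) (hs : ContinuousOn s (Ici t₀))
    (hIV : Real.pi ≤ ∫ τ in t₁..t₂,
      min (q τ * Real.exp (-∫ ζ in t₁..τ, (p ζ - s ζ)))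
        (-F τ * Real.exp (∫ ζ in t₁..τ, (p ζ - s ζ)))) :
    ∀ φ ψ : ℝ → ℝ,
      (∀ t ∈ Ici t₀,
        HasDerivWithinAt φ (p t * φ t + q t * ψ t) (Ici t₀) t ∧
        HasDerivWithinAt ψ (F t * φ t + s t * ψ t) (Ici t₀) t) →
      (∃ t ∈ Ici t₀, φ t ≠ 0 ∨ ψ t ≠ 0) →
      ∃ t ∈ Icc t₁ t₂, φ t = 0 := by
  intro φ ψ hsol _
  by_contra! hφ
  have hmax : ∀ {x}, t₁ ≤ x → max t₀ x = x := fun hx => max_eq_right (ht₀₁.trans hx)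
  have hPc : Continuous fun x => p (max t₀ x) - s (max t₀ x) :=
    hp.comp_max_Ici.sub hs.comp_max_Ici
  set D : ℝ → ℝ := fun t => ∫ ζ in t₁..t, (p (max t₀ ζ) - s (max t₀ ζ))
  have hDd : ∀ t, HasDerivAt D (p (max t₀ t) - s (max t₀ t)) t := fun t =>
    (hPc.integral_hasStrictDerivAt t₁ t).hasDerivAt
  have hDc : Continuous D := continuous_iff_continuousAt.2 fun t => (hDd t).continuousAt
  have hDeq : ∀ t, t₁ ≤ t → ∫ ζ in t₁..t, (p ζ - s ζ) = D t := by
    intro t ht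
    refine integral_congr fun ζ hζ => ?_
    rw [uIcc_of_le ht] at hζ
    simp only [hmax hζ.1]
  have hqc := hq.comp_max_Ici
  have hFc := hF.comp_max_Ici
  have hlt : ∫ τ in t₁..t₂, min (q (max t₀ τ) * Real.exp (-D τ))
      (-F (max t₀ τ) * Real.exp (D τ)) < Real.pi := by
    refine integral_lt_pi_of_riccati ht₁₂.le (z := fun t => ψ t / φ t * Real.exp (D t))
      (b := fun t => q (max t₀ t) * Real.exp (-D t))
      (c := fun t => F (max t₀ t) * Real.exp (D t)) 
      ((hqc.mul (Real.continuous_exp.comp hDc.neg)).min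
        (hFc.neg.mul (Real.continuous_exp.comp hDc))) ?_ ?_
      (fun t _ => min_le_left _ _) (fun t _ => (min_le_right _ _).trans_eq (neg_mul _ _))
    · have hsub : Icc t₁ t₂ ⊆ Ici t₀ := fun x hx => ht₀₁.trans hx.1
      have hφc : ContinuousOn φ (Icc t₁ t₂) := fun t ht =>
        (hsol t (hsub ht)).1.continuousWithinAt.mono hsub
      have hψc : ContinuousOn ψ (Icc t₁ t₂) := fun t ht =>
        (hsol t (hsub ht)).2.continuousWithinAt.mono hsub
      exact (hψc.div hφc hφ).mul (Real.continuous_exp.comp hDc).continuousOn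
    · intro t ht
      have ht₀ : t₀ < t := ht₀₁.trans_lt ht.1
      have hne : φ t ≠ 0 := hφ t (Ioo_subset_Icc_self ht)
      have hφd := (hsol t ht₀.le).1.hasDerivAt (Ici_mem_nhds ht₀)
      have hψd := (hsol t ht₀.le).2.hasDerivAt (Ici_mem_nhds ht₀)
      refine ((hψd.div hφd hne).mul (hDd t).exp).congr_deriv ?_
      simp only [hmax ht.1.le, Real.exp_neg, Pi.div_apply]
      have hexp := (Real.exp_pos (D t)).ne'
      field_simp
      ring
  refine hlt.not_ge (hIV.trans_eq (integral_congr fun τ hτ => ?_))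
  rw [uIcc_of_le ht₁₂.le] at hτ
  simp only [hDeq τ hτ.1, hmax hτ.1]
end
end
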